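/- Let k be an integer with 0 ≤ k ≤ n−3. For a flag g in F^n, let ĝ denote the maximal flag whose j-th subspace is the span of the first j columns of the minimal matrix representation of g, and let σ_g be the label of ĝ. Then the number of flags g in F^n with exactly k+1 subspaces such that σ_g is not the decreasing permutation and the t_{σ_g}-th subspace of ĝ does not belong to g equals the sum, over all permutations σ ∈ Σ_n that are not the decreasing permutation, of C(p_σ − 1, n−k−3) · q^{m_1(σ) + ⋯ + m_n(σ)}, where q is the cardinality of F, p_σ is the number of ascents of σ, t_σ is the smallest ascent of σ, and m_j(σ) = σ(j) − 1 − |{ℓ ∈ {1,…,j−1} : σ(ℓ) < σ(j)}|. -/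

import Mathlib

open Matrix

variable {n : ℕ} {F : Type} [Field F]

/-- `(r, j)` is a pivot position of `M`: the entry `M r j` is nonzero and all entries of
column `j` strictly below row `r` vanish (i.e. `r` is the largest row index with `M r j ≠ 0`). -/
def IsPivot (M : Matrix (Fin n) (Fin n) F) (r j : Fin n) : Prop :=
  M r j ≠ 0 ∧ ∀ r' : Fin n, r < r' → M r' j = 0

/-- The span of the first `j` columns of `M` (columns with index `< j` in 0-based indexing). -/
def colSpan (M : Matrix (Fin n) (Fin n) F) (j : ℕ) : Submodule F (Fin n → F) :=
  Submodule.span F ((fun i : Fin n => Mᵀ i) '' {i : Fin n | (i : ℕ) < j})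

/-- A flag: a nonempty finite set of proper nonzero subspaces of `F^n` forming a chain. -/
def IsFlag (g : Set (Submodule F (Fin n → F))) : Prop :=
  g.Finite ∧ g.Nonempty ∧ IsChain (· ≤ ·) g ∧ ∀ V ∈ g, V ≠ ⊥ ∧ V ≠ ⊤

/-- A maximal flag: a flag containing a subspace of every dimension `1,…,n-1`. -/
def IsMaximalFlag (f : Set (Submodule F (Fin n → F))) : Prop :=
  IsFlag f ∧ ∀ j : ℕ, 1 ≤ j → j ≤ n - 1 → ∃ V ∈ f, Module.finrank F V = j

/-- Conditions (i)–(iii) for a matrix representation of a flag `f`: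
(i) for every `V ∈ f` the first `dim V` columns of `M` span `V`, and all `n` columns span `F^n`;
(ii) every pivot entry equals `1`;
(iii) entries in the same row as a pivot and strictly to its right vanish. -/
def IsRep (f : Set (Submodule F (Fin n → F))) (M : Matrix (Fin n) (Fin n) F) : Prop :=
  (∀ V ∈ f, colSpan M (Module.finrank F V) = V) ∧
  colSpan M n = ⊤ ∧
  (∀ r j : Fin n, IsPivot M r j → M r j = 1) ∧
  (∀ r j j' : Fin n, IsPivot M r j → j < j' → M r j' = 0)

/-- Columns `i` and `i'` lie in the same block of the block decomposition induced by the
flag `g` (blocks are the intervals of columns between consecutive dimensions of members of `g`). -/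
def SameBlock (g : Set (Submodule F (Fin n → F))) (i i' : Fin n) : Prop :=
  ∀ V ∈ g, ((i : ℕ) < Module.finrank F V ↔ (i' : ℕ) < Module.finrank F V)

/-- The minimal matrix representation of a flag `g`: conditions (i)–(iii) together with
(iv) within each block, entries in the same row as a pivot of the block and strictly to its left
within the block vanish; (v) within each block, pivot row indices strictly increase. -/
def IsMinRep (g : Set (Submodule F (Fin n → F))) (M : Matrix (Fin n) (Fin n) F) : Prop :=
  IsRep g M ∧
  (∀ r i i' : Fin n, SameBlock g i i' → IsPivot M r i → i' < i → M r i' = 0) ∧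
  (∀ r r' i i' : Fin n, SameBlock g i i' → IsPivot M r i → IsPivot M r' i' → i < i' → r < r')

/-- `σ` is the label of the maximal flag `f`: `σ j` is the pivot row of the `j`-th column of
the minimal matrix representation of `f`. -/
def IsLabel (f : Set (Submodule F (Fin n → F))) (σ : Equiv.Perm (Fin n)) : Prop :=
  ∃ M : Matrix (Fin n) (Fin n) F, IsRep f M ∧ ∀ j : Fin n, IsPivot M (σ j) j

/-- Strict lexicographic order on permutations in one-line notation `(σ 0, …, σ (n-1))`. -/
def LexLt {n : ℕ} (σ τ : Equiv.Perm (Fin n)) : Prop :=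
  ∃ j : Fin n, (∀ i : Fin n, i < j → σ i = τ i) ∧ σ j < τ j

/-- `σ` is the lexicographically least label among the labels of maximal flags containing `g`. -/
def IsMinlabel (g : Set (Submodule F (Fin n → F))) (σ : Equiv.Perm (Fin n)) : Prop :=
  (∃ f, IsMaximalFlag f ∧ g ⊆ f ∧ IsLabel f σ) ∧
  ∀ (f : Set (Submodule F (Fin n → F))) (τ : Equiv.Perm (Fin n)),
    IsMaximalFlag f → g ⊆ f → IsLabel f τ → σ = τ ∨ LexLt σ τ

/-- `t` is a (0-based) ascent of `σ`: `σ t < σ (t+1)`.  (In the 1-based indexing of the paper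
this corresponds to the ascent `(σ(t+1), σ(t+2))` at position `t+1`.) -/
def Ascent {n : ℕ} (σ : Equiv.Perm (Fin n)) (t : ℕ) : Prop :=
  ∃ h : t + 1 < n, σ ⟨t, Nat.lt_of_succ_lt h⟩ < σ ⟨t + 1, h⟩

/-- `σ` is the decreasing permutation `σ(j) = n + 1 - j` (in 0-based indexing, `n - 1 - j`). -/
def IsDecreasing {n : ℕ} (σ : Equiv.Perm (Fin n)) : Prop :=
  ∀ j : Fin n, (σ j : ℕ) = n - 1 - (j : ℕ)

open scoped Classical

section PivotSystems

variable {M : Matrix (Fin n) (Fin n) F} {σ : Equiv.Perm (Fin n)}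

theorem IsPivot.unique {r r' j : Fin n} (h : IsPivot M r j) (h' : IsPivot M r' j) : r = r' := by
  rcases lt_trichotomy r r' with hlt | rfl | hlt
  · exact absurd (h.2 r' hlt) h'.1
  · rfl
  · exact absurd (h'.2 r hlt) h.1

theorem exists_last_ne_zero {v : Fin n → F} (hv : v ≠ 0) :
    ∃ r, v r ≠ 0 ∧ ∀ r', r < r' → v r' = 0 := by
  obtain ⟨r₀, hr₀⟩ := Function.ne_iff.mp hv
  obtain ⟨r, hr, hmax⟩ := (Finset.univ.filter fun r => v r ≠ 0).exists_max_image id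
    ⟨r₀, by simpa using hr₀⟩
  refine ⟨r, by simpa using hr, fun r' hlt => ?_⟩
  by_contra hne
  exact absurd (hmax r' (by simpa using hne)) (not_le.mpr hlt)

/-- The last nonzero entry of a nontrivial combination of columns with distinct pivots is located
in the pivot row of one of the columns involved. -/
theorem exists_last_ne_zero_of_sum (hσ : ∀ j, IsPivot M (σ j) j) {c : Fin n → F} (hc : c ≠ 0) :
    ∃ i, c i ≠ 0 ∧ (∑ l, c l • Mᵀ l) (σ i) ≠ 0 ∧ ∀ r, σ i < r → (∑ l, c l • Mᵀ l) r = 0 := by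
  obtain ⟨i₀, hi₀⟩ := Function.ne_iff.mp hc
  obtain ⟨i, hi, hmax⟩ := (Finset.univ.filter fun i => c i ≠ 0).exists_max_image σ
    ⟨i₀, by simpa using hi₀⟩
  have hi' : c i ≠ 0 := by simpa using hi
  have hmax' : ∀ l, c l ≠ 0 → σ l ≤ σ i := fun l hl => hmax l (by simpa using hl)
  refine ⟨i, hi', ?_, fun r hr => ?_⟩
  · rw [Finset.sum_apply, Finset.sum_eq_single i]
    · simpa using ⟨hi', (hσ i).1⟩
    · intro l _ hl
      by_cases h0 : c l = 0
      · simp [h0]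
      · have : σ l < σ i := lt_of_le_of_ne (hmax' l h0) (fun h => hl (σ.injective h))
        simp [(hσ l).2 _ this]
    · simp
  · rw [Finset.sum_apply]
    refine Finset.sum_eq_zero fun l _ => ?_
    by_cases h0 : c l = 0
    · simp [h0]
    · simp [(hσ l).2 _ ((hmax' l h0).trans_lt hr)]

theorem linearIndependent_of_isPivot (hσ : ∀ j, IsPivot M (σ j) j) :
    LinearIndependent F (fun i => Mᵀ i) := by
  rw [Fintype.linearIndependent_iff]
  intro c hc
  by_contra! hne
  obtain ⟨i₀, hi₀⟩ := hne
  obtain ⟨i, -, hi, -⟩ := exists_last_ne_zero_of_sum hσ (c := c) (Function.ne_iff.mpr ⟨i₀, hi₀⟩)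
  exact hi (by rw [hc]; rfl)

theorem transpose_mem_colSpan {i : Fin n} {d : ℕ} (h : (i : ℕ) < d) : Mᵀ i ∈ colSpan M d :=
  Submodule.subset_span ⟨i, h, rfl⟩

theorem colSpan_mono {d e : ℕ} (h : d ≤ e) : colSpan M d ≤ colSpan M e :=
  Submodule.span_mono (Set.image_mono fun _ hi => lt_of_lt_of_le hi h)

theorem finrank_colSpan (hσ : ∀ j, IsPivot M (σ j) j) {d : ℕ} (hd : d ≤ n) :
    Module.finrank F (colSpan M d) = d := by
  have hli := linearIndependent_of_isPivot hσ
  have h := finrank_span_eq_card (hli.comp (Fin.castLE hd) (Fin.castLE_injective hd))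
  rw [Fintype.card_fin] at h
  have himg : (fun i : Fin n => Mᵀ i) '' {i : Fin n | (i : ℕ) < d} =
      Set.range ((fun i : Fin n => Mᵀ i) ∘ Fin.castLE hd) := by
    ext v
    constructor
    · rintro ⟨i, hi, rfl⟩
      exact ⟨⟨i, hi⟩, rfl⟩
    · rintro ⟨i, rfl⟩
      exact ⟨Fin.castLE hd i, i.2, rfl⟩
  rw [colSpan, himg]
  exact h

theorem colSpan_eq_top (hσ : ∀ j, IsPivot M (σ j) j) : colSpan M n = ⊤ :=
  Submodule.eq_top_of_finrank_eq (by rw [finrank_colSpan hσ le_rfl]; simp)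

theorem colSpan_inj (hσ : ∀ j, IsPivot M (σ j) j) {d e : ℕ} (hd : d ≤ n) (he : e ≤ n)
    (h : colSpan M d = colSpan M e) : d = e := by
  rw [← finrank_colSpan hσ hd, h, finrank_colSpan hσ he]

theorem symm_lt_of_mem_colSpan (hσ : ∀ j, IsPivot M (σ j) j) {d : ℕ} {v : Fin n → F}
    (hv : v ∈ colSpan M d) {r : Fin n} (hr : v r ≠ 0) (hlast : ∀ r', r < r' → v r' = 0) :
    (σ.symm r : ℕ) < d := by
  rw [colSpan, Submodule.mem_span_image_iff_exists_fun] at hv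
  obtain ⟨t, ht, c, rfl⟩ := hv
  set c' : Fin n → F := fun i => if h : i ∈ t then c ⟨i, h⟩ else 0 with hc'
  have hsum : ∑ i : t, c i • Mᵀ (i : Fin n) = ∑ i, c' i • Mᵀ i := by
    rw [← Finset.sum_subset (Finset.subset_univ t) (fun i _ hi => by simp [hc', hi]),
      ← Finset.sum_coe_sort t]
    exact Finset.sum_congr rfl fun i _ => by simp [hc']
  rw [hsum] at hr hlast
  have hne : c' ≠ 0 := by
    intro h0
    simp [h0] at hr
  obtain ⟨i, hi, hi1, hi2⟩ := exists_last_ne_zero_of_sum hσ hne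
  have hri : r = σ i := by
    rcases lt_trichotomy r (σ i) with h | h | h
    · exact absurd (hlast _ h) hi1
    · exact h
    · exact absurd (hi2 _ h) hr
  have hit : i ∈ t := by
    by_contra h
    simp [hc', h] at hi
  rw [hri, Equiv.symm_apply_apply]
  exact ht hit

/-- Two matrices with the same span of the first `d` columns have the same pivot rows there. -/
theorem lt_iff_of_colSpan_eq {M' : Matrix (Fin n) (Fin n) F} {σ' : Equiv.Perm (Fin n)}
    (hσ : ∀ j, IsPivot M (σ j) j) (hσ' : ∀ j, IsPivot M' (σ' j) j) {d : ℕ}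
    (h : colSpan M d = colSpan M' d) {i j : Fin n} (hij : σ j = σ' i) :
    (j : ℕ) < d ↔ (i : ℕ) < d := by
  constructor
  · intro hj
    have := symm_lt_of_mem_colSpan hσ' (h.le (transpose_mem_colSpan hj)) (r := σ j) (hσ j).1 (hσ j).2
    simpa [hij] using this
  · intro hi
    have := symm_lt_of_mem_colSpan hσ (h.ge (transpose_mem_colSpan hi)) (r := σ' i) (hσ' i).1 (hσ' i).2
    simpa [← hij] using this

/-- A matrix representation has a permutation of pivot rows. -/
theorem IsRep.exists_perm {g : Set (Submodule F (Fin n → F))} (h : IsRep g M) :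
    ∃ σ : Equiv.Perm (Fin n), ∀ j, IsPivot M (σ j) j := by
  obtain ⟨-, htop, -, hright⟩ := h
  have hli : LinearIndependent F (fun i => Mᵀ i) := by
    refine linearIndependent_of_top_le_span_of_card_eq_finrank ?_ (by simp)
    rw [← htop]
    exact Submodule.span_mono (Set.image_subset_range _ _)
  choose f hf using fun j => exists_last_ne_zero (hli.ne_zero j)
  have hpiv : ∀ j, IsPivot M (f j) j := hf
  have hinj : Function.Injective f := by
    intro i j hij
    rcases lt_trichotomy i j with hlt | rfl | hlt
    · exact absurd (hright _ _ _ (hpiv i) hlt) (hij ▸ (hpiv j).1)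
    · rfl
    · exact absurd (hright _ _ _ (hpiv j) hlt) (hij ▸ (hpiv i).1)
  exact ⟨Equiv.ofBijective f (Finite.injective_iff_bijective.mp hinj), hpiv⟩

theorem isRep_iff (hσ : ∀ j, IsPivot M (σ j) j) {g : Set (Submodule F (Fin n → F))} :
    IsRep g M ↔ (∀ V ∈ g, colSpan M (Module.finrank F V) = V) ∧ (∀ j, M (σ j) j = 1) ∧
      ∀ j j', j < j' → M (σ j) j' = 0 := by
  constructor
  · rintro ⟨h1, -, h3, h4⟩
    exact ⟨h1, fun j => h3 _ _ (hσ j), fun j j' => h4 _ _ _ (hσ j)⟩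
  · rintro ⟨h1, h3, h4⟩
    refine ⟨h1, colSpan_eq_top hσ, fun r j h => ?_, fun r j j' h => ?_⟩
    · rw [h.unique (hσ j)]; exact h3 j
    · rw [h.unique (hσ j)]; exact h4 j j'

theorem isMinRep_iff (hσ : ∀ j, IsPivot M (σ j) j) {g : Set (Submodule F (Fin n → F))} :
    IsMinRep g M ↔ IsRep g M ∧ ∀ i i', SameBlock g i i' → i < i' → σ i < σ i' := by
  constructor
  · rintro ⟨h, -, h2⟩
    exact ⟨h, fun i i' hb => h2 _ _ i i' hb (hσ i) (hσ i')⟩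
  · rintro ⟨h, h2⟩
    refine ⟨h, fun r i i' hb hr hlt => ?_, fun r r' i i' hb hr hr' hlt => ?_⟩
    · rw [hr.unique (hσ i)]
      exact (hσ i').2 _ (h2 i' i (fun V hV => (hb V hV).symm) hlt)
    · rw [hr.unique (hσ i), hr'.unique (hσ i')]
      exact h2 i i' hb hlt

/-- Two minimal matrix representations of the same flag have the same pivot rows. -/
theorem IsMinRep.perm_eq {M' : Matrix (Fin n) (Fin n) F} {σ' : Equiv.Perm (Fin n)}
    {g : Set (Submodule F (Fin n → F))} (h : IsMinRep g M) (h' : IsMinRep g M')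
    (hσ : ∀ j, IsPivot M (σ j) j) (hσ' : ∀ j, IsPivot M' (σ' j) j) : σ = σ' := by
  have key : ∀ i j, σ j = σ' i → SameBlock g j i := fun i j hij V hV =>
    lt_iff_of_colSpan_eq hσ hσ' ((h.1.1 V hV).trans (h'.1.1 V hV).symm) hij
  have hinc := ((isMinRep_iff hσ).mp h).2
  have hinc' := ((isMinRep_iff hσ').mp h').2
  ext1 j
  induction j using WellFoundedLT.induction with
  | _ j ih =>
    obtain ⟨i, hi⟩ := σ'.surjective (σ j)
    obtain ⟨l, hl⟩ := σ.surjective (σ' j)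
    rcases lt_trichotomy i j with hlt | rfl | hlt
    · exact absurd (σ.injective ((ih i hlt).trans hi)) hlt.ne
    · exact hi.symm
    · rcases lt_trichotomy l j with hlt' | rfl | hlt'
      · exact absurd (σ'.injective ((ih l hlt').symm.trans hl)) hlt'.ne
      · exact hl
      · have h1 := hinc' j i (key i j hi.symm) hlt
        have h2 := hinc j l (fun V hV => (key j l hl V hV).symm) hlt'
        rw [hi] at h1
        rw [hl] at h2
        exact absurd h1 h2.not_gt

/-- The minimal matrix representation of a flag is unique. -/
theorem IsMinRep.unique {M' : Matrix (Fin n) (Fin n) F} {g : Set (Submodule F (Fin n → F))}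
    (h : IsMinRep g M) (h' : IsMinRep g M') : M = M' := by
  obtain ⟨σ, hσ⟩ := h.1.exists_perm
  obtain ⟨σ', hσ'⟩ := h'.1.exists_perm
  obtain rfl := h.perm_eq h' hσ hσ'
  obtain ⟨hspan, hone, hright⟩ := (isRep_iff hσ).mp h.1
  obtain ⟨hspan', hone', hright'⟩ := (isRep_iff hσ').mp h'.1
  apply Matrix.transpose_injective
  funext j
  by_contra hne
  obtain ⟨r, hr, hlast⟩ := exists_last_ne_zero (sub_ne_zero.mpr hne)
  obtain ⟨i, rfl⟩ := σ.surjective r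
  refine hr (sub_eq_zero.mpr ?_)
  change M (σ i) j = M' (σ i) j
  rcases lt_trichotomy i j with hlt | rfl | hlt
  · rw [hright i j hlt, hright' i j hlt]
  · rw [hone, hone']
  · have hb : SameBlock g i j := by
      intro V hV
      refine ⟨fun hi => lt_trans hlt hi, fun hj => ?_⟩
      have hmem : Mᵀ j - M'ᵀ j ∈ colSpan M (Module.finrank F V) := by
        refine sub_mem (transpose_mem_colSpan hj) ?_
        rw [hspan V hV, ← hspan' V hV]
        exact transpose_mem_colSpan hj
      simpa using symm_lt_of_mem_colSpan hσ hmem hr hlast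
    rw [h.2.1 _ i j hb (hσ i) hlt, h'.2.1 _ i j hb (hσ' i) hlt]

/-- The label of the maximal flag spanned by the columns of `M` is the permutation of pivots. -/
theorem isLabel_colSpan_iff (hσ : ∀ j, IsPivot M (σ j) j) (hone : ∀ j, M (σ j) j = 1)
    (hright : ∀ j j', j < j' → M (σ j) j' = 0) {τ : Equiv.Perm (Fin n)} :
    IsLabel (colSpan M '' Set.Icc 1 (n - 1)) τ ↔ τ = σ := by
  constructor
  · rintro ⟨M', hM', hτ⟩
    ext1 i
    obtain ⟨j, hj⟩ := σ.surjective (τ i)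
    have key : ∀ d, 1 ≤ d → d ≤ n - 1 → ((j : ℕ) < d ↔ (i : ℕ) < d) := by
      intro d h1 h2
      have h := hM'.1 _ ⟨d, ⟨h1, h2⟩, rfl⟩
      rw [finrank_colSpan hσ (h2.trans (Nat.sub_le _ _))] at h
      exact lt_iff_of_colSpan_eq hσ hτ h.symm hj
    have hij : j = i := by
      have hi := i.2
      have hj := j.2
      have k1 := key ((i : ℕ) + 1)
      have k2 := key ((j : ℕ) + 1)
      ext
      omega
    rw [← hj, hij]
  · rintro rfl
    refine ⟨M, (isRep_iff hσ).mpr ⟨?_, hone, hright⟩, hσ⟩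
    rintro _ ⟨d, hd, rfl⟩
    rw [finrank_colSpan hσ (hd.2.trans (Nat.sub_le _ _))]

end PivotSystems

section Ascents

variable {σ : Equiv.Perm (Fin n)}

/-- The finset of ascents of a permutation. -/
noncomputable def ascents (σ : Equiv.Perm (Fin n)) : Finset ℕ :=
  (Finset.range (n - 1)).filter (Ascent σ)

theorem mem_ascents {t : ℕ} : t ∈ ascents σ ↔ Ascent σ t := by
  simp only [ascents, Finset.mem_filter, Finset.mem_range, and_iff_right_iff_imp]
  rintro ⟨h, -⟩
  omega

theorem ncard_setOf_ascent : {t : ℕ | Ascent σ t}.ncard = (ascents σ).card := by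
  rw [← Set.ncard_coe_finset]
  congr 1
  ext t
  simp [mem_ascents]

theorem exists_ascent_of_not_isDecreasing (h : ¬ IsDecreasing σ) : ∃ t, Ascent σ t := by
  by_contra! hno
  apply h
  have hanti : StrictAnti σ := by
    cases n with
    | zero => exact fun i => i.elim0
    | succ m =>
      rw [Fin.strictAnti_iff_succ_lt]
      intro i
      have hi : ¬ σ i.castSucc < σ i.succ := fun hlt =>
        hno i ⟨by have := i.2; omega, hlt⟩
      exact lt_of_le_of_ne (not_lt.mp hi) fun he =>
        absurd (σ.injective he) (Fin.castSucc_lt_succ).ne'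
  have hmono : StrictMono fun i => σ (Fin.rev i) := fun i j hij =>
    hanti (Fin.rev_lt_rev.mpr hij)
  intro j
  have := congrFun hmono.eq_id (Fin.rev j)
  simp only [Fin.rev_rev, id] at this
  rw [this, Fin.val_rev]
  omega

theorem lt_of_ascents {i j : Fin n} (hij : i < j)
    (h : ∀ t : ℕ, (i : ℕ) ≤ t → t < j → Ascent σ t) : σ i < σ j := by
  have key : ∀ m : ℕ, ∀ hm : m < n, (i : ℕ) < m → m ≤ j → σ i < σ ⟨m, hm⟩ := by
    intro m
    induction m with
    | zero => intro _ h0; omega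
    | succ m ih =>
      intro hm him hmj
      obtain ⟨_, hlt⟩ := h m (by omega) (by omega)
      rcases Nat.lt_or_ge i m with h1 | h1
      · exact (ih (by omega) h1 (by omega)).trans hlt
      · have : i = ⟨m, by omega⟩ := Fin.ext (by simp; omega)
        rw [this]
        exact hlt
  exact key j j.2 hij le_rfl

end Ascents

section Counting

/-- Entry `(r, j)` of a normalized matrix with pivot rows `σ` can be chosen freely. -/
def IsFree (σ : Equiv.Perm (Fin n)) (r j : Fin n) : Prop :=
  r < σ j ∧ ∀ l, l < j → σ l ≠ r

/-- The matrices with pivot rows `σ` satisfying conditions (ii) and (iii). -/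
noncomputable def normalized (F : Type) [Field F] [Fintype F] (σ : Equiv.Perm (Fin n)) :
    Finset (Matrix (Fin n) (Fin n) F) :=
  Finset.univ.filter fun M =>
    (∀ j, IsPivot M (σ j) j) ∧ (∀ j, M (σ j) j = 1) ∧ ∀ j j', j < j' → M (σ j) j' = 0

theorem normalized_iff {M : Matrix (Fin n) (Fin n) F} {σ : Equiv.Perm (Fin n)} :
    ((∀ j, IsPivot M (σ j) j) ∧ (∀ j, M (σ j) j = 1) ∧ ∀ j j', j < j' → M (σ j) j' = 0) ↔
      ∀ r j, ¬ IsFree σ r j → M r j = if r = σ j then 1 else 0 := by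
  constructor
  · rintro ⟨h1, h2, h3⟩ r j hfree
    split_ifs with hr
    · rw [hr, h2]
    · by_cases hlt : σ j < r
      · exact (h1 j).2 r hlt
      · have hlt' : r < σ j := lt_of_le_of_ne (not_lt.mp hlt) hr
        obtain ⟨l, hl, rfl⟩ : ∃ l, l < j ∧ σ l = r := by
          by_contra! hcon
          exact hfree ⟨hlt', hcon⟩
        exact h3 l j hl
  · intro h
    have hone : ∀ j, M (σ j) j = 1 := fun j => by
      rw [h _ _ fun hf => lt_irrefl _ hf.1, if_pos rfl]
    refine ⟨fun j => ⟨by rw [hone]; exact one_ne_zero, fun r hr => ?_⟩, hone, fun j j' hlt => ?_⟩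
    · rw [h _ _ fun hf => lt_asymm hf.1 hr, if_neg hr.ne']
    · rw [h _ _ fun hf => hf.2 j hlt rfl, if_neg fun he => hlt.ne (σ.injective he)]

theorem card_filter_isFree (σ : Equiv.Perm (Fin n)) (j : Fin n) :
    (Finset.univ.filter fun r => IsFree σ r j).card =
      (σ j : ℕ) - {l : Fin n | l < j ∧ σ l < σ j}.ncard := by
  have hset : (Finset.univ.filter fun r => IsFree σ r j) =
      Finset.Iio (σ j) \ (Finset.univ.filter fun l => l < j ∧ σ l < σ j).image σ := by
    ext r
    rw [Finset.mem_filter_univ]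
    simp only [IsFree, Finset.mem_filter, Finset.mem_univ, true_and, Finset.mem_sdiff,
      Finset.mem_Iio, Finset.mem_image, not_exists, not_and, and_imp]
    refine and_congr_right fun hr => forall_congr' fun l => forall_congr' fun hl => ?_
    exact ⟨fun h _ => h, fun h he => h (he ▸ hr) he⟩
  rw [hset, Finset.card_sdiff_of_subset, Finset.card_image_of_injective _ σ.injective, Fin.card_Iio,
    ← Set.ncard_coe_finset]
  · simp
  · intro r hr
    simp only [Finset.mem_image, Finset.mem_filter] at hr
    obtain ⟨l, ⟨-, -, hl⟩, rfl⟩ := hr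
    exact Finset.mem_Iio.mpr hl

theorem card_normalized [Fintype F] (σ : Equiv.Perm (Fin n)) :
    (normalized F σ).card = Fintype.card F ^
      (∑ j : Fin n, ((σ j : ℕ) - {l : Fin n | l < j ∧ σ l < σ j}.ncard)) := by
  have hpi : normalized F σ = Fintype.piFinset fun r => Fintype.piFinset fun j =>
      if IsFree σ r j then (Finset.univ : Finset F) else {if r = σ j then 1 else 0} := by
    ext M
    rw [normalized, Finset.mem_filter, normalized_iff]
    simp only [Finset.mem_univ, true_and]
    refine Iff.trans ?_ Fintype.mem_piFinset.symm
    refine forall_congr' fun r => Iff.trans ?_ Fintype.mem_piFinset.symm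
    refine forall_congr' fun j => ?_
    by_cases hf : IsFree σ r j <;> simp [hf]
  have hcard : (normalized F σ).card =
      ∏ r, ∏ j, if IsFree σ r j then Fintype.card F else 1 := by
    rw [hpi]
    refine (Fintype.card_piFinset _).trans (Finset.prod_congr rfl fun r _ => ?_)
    refine (Fintype.card_piFinset _).trans (Finset.prod_congr rfl fun j _ => ?_)
    split_ifs <;> simp
  rw [hcard, Finset.prod_comm, ← Finset.prod_pow_eq_pow_sum]
  refine Finset.prod_congr rfl fun j _ => ?_
  rw [← card_filter_isFree, Finset.prod_ite, Finset.prod_const, Finset.prod_const_one, mul_one]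

end Counting

section CriticalFlags

/-- The flag with subspaces `colSpan M (e + 1)` for `e < n - 1` outside of `C`. -/
def flagOmitting (M : Matrix (Fin n) (Fin n) F) (C : Finset ℕ) :
    Set (Submodule F (Fin n → F)) :=
  (fun e => colSpan M (e + 1)) '' ↑(Finset.range (n - 1) \ C)

variable {M : Matrix (Fin n) (Fin n) F} {σ : Equiv.Perm (Fin n)} {C : Finset ℕ}

theorem colSpan_mem_flagOmitting_iff (hσ : ∀ j, IsPivot M (σ j) j) {e : ℕ} (he : e < n - 1) :
    colSpan M (e + 1) ∈ flagOmitting M C ↔ e ∉ C := by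
  constructor
  · rintro ⟨e', he', h⟩
    simp only [Finset.coe_sdiff, Set.mem_sdiff, Finset.mem_coe, Finset.mem_range] at he'
    have := colSpan_inj hσ (by omega) (by omega) h
    obtain rfl : e' = e := by omega
    exact he'.2
  · intro h
    exact ⟨e, by simp [he, h], rfl⟩

theorem ncard_flagOmitting (hσ : ∀ j, IsPivot M (σ j) j) (hC : C ⊆ Finset.range (n - 1)) :
    (flagOmitting M C).ncard = n - 1 - C.card := by
  rw [flagOmitting, Set.InjOn.ncard_image, Set.ncard_coe_finset,
    Finset.card_sdiff_of_subset hC, Finset.card_range]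
  intro e he e' he' h
  simp only [Finset.coe_sdiff, Set.mem_sdiff, Finset.mem_coe, Finset.mem_range] at he he'
  have := colSpan_inj hσ (by omega) (by omega) h
  omega

theorem isFlag_flagOmitting (hσ : ∀ j, IsPivot M (σ j) j) (hne : (flagOmitting M C).Nonempty) :
    IsFlag (flagOmitting M C) := by
  refine ⟨(Finset.finite_toSet _).image _, hne, ?_, ?_⟩
  · rintro _ ⟨d, -, rfl⟩ _ ⟨e, -, rfl⟩ -
    exact (le_total d e).imp (fun h => colSpan_mono (by omega)) fun h => colSpan_mono (by omega)
  · rintro _ ⟨e, he, rfl⟩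
    simp only [Finset.coe_sdiff, Set.mem_sdiff, Finset.mem_coe, Finset.mem_range] at he
    have hrank := finrank_colSpan hσ (d := e + 1) (by omega)
    constructor
    · intro h
      rw [show colSpan M (e + 1) = ⊥ from h, finrank_bot] at hrank
      omega
    · intro h
      rw [show colSpan M (e + 1) = ⊤ from h, finrank_top, Module.finrank_fin_fun] at hrank
      omega

theorem isMinRep_flagOmitting (hσ : ∀ j, IsPivot M (σ j) j) (hone : ∀ j, M (σ j) j = 1)
    (hright : ∀ j j', j < j' → M (σ j) j' = 0) (hC : C ⊆ ascents σ) :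
    IsMinRep (flagOmitting M C) M := by
  rw [isMinRep_iff hσ, isRep_iff hσ]
  refine ⟨⟨?_, hone, hright⟩, fun i i' hb hlt => lt_of_ascents hlt fun t hit hti => ?_⟩
  · rintro _ ⟨e, he, rfl⟩
    simp only [Finset.coe_sdiff, Set.mem_sdiff, Finset.mem_coe, Finset.mem_range] at he
    rw [finrank_colSpan hσ (by omega)]
  · have hi' := i'.2
    by_contra hasc
    have hmem : colSpan M (t + 1) ∈ flagOmitting M C :=
      (colSpan_mem_flagOmitting_iff hσ (by omega)).mpr
        fun h => hasc (mem_ascents.mp (hC h))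
    have := hb _ hmem
    rw [finrank_colSpan hσ (by omega)] at this
    omega

/-- Every flag with a minimal representation `M` omits a set of ascents of its pivots. -/
theorem IsMinRep.exists_eq_flagOmitting {g : Set (Submodule F (Fin n → F))} (h : IsMinRep g M)
    (hg : IsFlag g) (hσ : ∀ j, IsPivot M (σ j) j) :
    ∃ C ⊆ ascents σ, g = flagOmitting M C := by
  refine ⟨(Finset.range (n - 1)).filter fun e => colSpan M (e + 1) ∉ g, ?_, ?_⟩
  · intro e he
    simp only [Finset.mem_filter, Finset.mem_range] at he
    rw [mem_ascents]
    refine ⟨by omega, ((isMinRep_iff hσ).mp h).2 _ _ (fun V hV => ?_) (by simp [Fin.lt_def])⟩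
    have hne : Module.finrank F V ≠ e + 1 := fun heq => he.2 (by
      rw [← heq, h.1.1 V hV]
      exact hV)
    simp only
    omega
  · ext V
    constructor
    · intro hV
      have hpos : Module.finrank F V ≠ 0 := fun h0 =>
        (hg.2.2.2 V hV).1 (Submodule.finrank_eq_zero.mp h0)
      have hlt : Module.finrank F V < n := by
        simpa using Submodule.finrank_lt (hg.2.2.2 V hV).2
      have hspan := h.1.1 V hV
      refine ⟨Module.finrank F V - 1, ?_, ?_⟩
      · have : Module.finrank F V - 1 + 1 = Module.finrank F V := by omega
        simp only [Finset.coe_sdiff, Set.mem_sdiff, Finset.mem_coe, Finset.mem_range,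
          Finset.mem_filter, this, hspan, hV, not_true_eq_false, and_false, not_false_eq_true,
          and_true]
        omega
      · simp only [Nat.sub_add_cancel (Nat.one_le_iff_ne_zero.mpr hpos), hspan]
    · rintro ⟨e, he, rfl⟩
      simp only [Finset.coe_sdiff, Set.mem_sdiff, Finset.mem_coe, Finset.mem_range,
        Finset.mem_filter, not_and, not_not] at he
      exact he.2 he.1

theorem flagOmitting_inj (hσ : ∀ j, IsPivot M (σ j) j) {C' : Finset ℕ}
    (hC : C ⊆ Finset.range (n - 1)) (hC' : C' ⊆ Finset.range (n - 1))
    (h : flagOmitting M C = flagOmitting M C') : C = C' := by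
  ext e
  by_cases he : e < n - 1
  · rw [← not_iff_not, ← colSpan_mem_flagOmitting_iff hσ he, h,
      colSpan_mem_flagOmitting_iff hσ he]
  · have : e ∉ Finset.range (n - 1) := by simpa using he
    exact iff_of_false (fun h => this (hC h)) fun h => this (hC' h)

/-- The smallest ascent of a permutation. -/
noncomputable def firstAscent (σ : Equiv.Perm (Fin n)) : ℕ :=
  sInf {t | Ascent σ t}

theorem ascent_firstAscent (h : ¬ IsDecreasing σ) : Ascent σ (firstAscent σ) :=
  Nat.sInf_mem (exists_ascent_of_not_isDecreasing h)

/-- The data parametrizing the critical flags: a permutation that is not decreasing, a normalized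
matrix, and the omitted ascents other than the first one. -/
noncomputable def criticalData (F : Type) [Field F] [Fintype F] (n k : ℕ) :
    Finset (Σ _ : Equiv.Perm (Fin n), Matrix (Fin n) (Fin n) F × Finset ℕ) :=
  (Finset.univ.filter fun σ : Equiv.Perm (Fin n) => ¬ IsDecreasing σ).sigma fun σ =>
    normalized F σ ×ˢ ((ascents σ).erase (firstAscent σ)).powersetCard (n - k - 3)

theorem mem_criticalData [Fintype F] {k : ℕ} {N : Finset ℕ} :
    (⟨σ, M, N⟩ : Σ _ : Equiv.Perm (Fin n), Matrix (Fin n) (Fin n) F × Finset ℕ) ∈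
      criticalData F n k ↔ ¬ IsDecreasing σ ∧ ((∀ j, IsPivot M (σ j) j) ∧
        (∀ j, M (σ j) j = 1) ∧ ∀ j j', j < j' → M (σ j) j' = 0) ∧
        N ⊆ (ascents σ).erase (firstAscent σ) ∧ N.card = n - k - 3 := by
  simp [criticalData, normalized, Finset.mem_powersetCard]

theorem insert_firstAscent_subset (h : ¬ IsDecreasing σ) {N : Finset ℕ}
    (hN : N ⊆ (ascents σ).erase (firstAscent σ)) : insert (firstAscent σ) N ⊆ ascents σ :=
  Finset.insert_subset (mem_ascents.mpr (ascent_firstAscent h))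
    (hN.trans (Finset.erase_subset _ _))

theorem card_criticalData [Fintype F] (k : ℕ) :
    (criticalData F n k).card = ∑ σ : Equiv.Perm (Fin n),
        if IsDecreasing σ then 0
        else Nat.choose ({t : ℕ | Ascent σ t}.ncard - 1) (n - k - 3) *
          Fintype.card F ^
            (∑ j : Fin n, ((σ j : ℕ) - {l : Fin n | l < j ∧ σ l < σ j}.ncard)) := by
  rw [criticalData, Finset.card_sigma, Finset.sum_filter]
  refine Finset.sum_congr rfl fun σ _ => ?_
  by_cases h : IsDecreasing σ
  · simp [h]
  · rw [if_pos h, if_neg h, Finset.card_product, card_normalized, Finset.card_powersetCard,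
      Finset.card_erase_of_mem (mem_ascents.mpr (ascent_firstAscent h)), ncard_setOf_ascent,
      mul_comm]

theorem injOn_flagOmitting_criticalData [Fintype F] (k : ℕ) :
    Set.InjOn (fun x : Σ _ : Equiv.Perm (Fin n), Matrix (Fin n) (Fin n) F × Finset ℕ =>
      flagOmitting x.2.1 (insert (firstAscent x.1) x.2.2)) (criticalData F n k) := by
  rintro ⟨σ, M, N⟩ hx ⟨σ', M', N'⟩ hx' heq
  obtain ⟨hdec, ⟨hσ, hone, hright⟩, hN, -⟩ := mem_criticalData.mp (Finset.mem_coe.mp hx)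
  obtain ⟨hdec', ⟨hσ', hone', hright'⟩, hN', -⟩ := mem_criticalData.mp (Finset.mem_coe.mp hx')
  simp only at heq
  have hC := insert_firstAscent_subset hdec hN
  have hC' := insert_firstAscent_subset hdec' hN'
  have hmin := isMinRep_flagOmitting hσ hone hright hC
  have hmin' := isMinRep_flagOmitting hσ' hone' hright' hC'
  rw [← heq] at hmin'
  obtain rfl := hmin.perm_eq hmin' hσ hσ'
  obtain rfl := hmin.unique hmin'
  have hins := flagOmitting_inj hσ (hC.trans (Finset.filter_subset _ _))
    (hC'.trans (Finset.filter_subset _ _)) heq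
  have hNN : N = N' := by
    rw [← Finset.erase_insert (fun h => Finset.notMem_erase _ _ (hN h)), hins,
      Finset.erase_insert fun h => Finset.notMem_erase _ _ (hN' h)]
  rw [hNN]

end CriticalFlags

/-- for `0 ≤ k ≤ n-3`, the number of flags `g` with `k+1` subspaces whose
associated label `σ_g` (the label of the maximal flag `ĝ` spanned by the columns of the
minimal matrix representation `M` of `g`) is not the decreasing permutation and such that the
`t_{σ_g}`-th subspace of `ĝ` (i.e. the span of the first `t+1` columns of `M`, `t` the smallest
ascent) does not belong to `g`, equals
`∑_{σ not decreasing} C(p_σ - 1, n-k-3) · q^{m_1(σ)+⋯+m_n(σ)}`. -/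
theorem card_critical_k_simplices_total
    [Fintype F] (hn : 3 ≤ n) (k : ℕ) (hk : k ≤ n - 3) :
    {g : Set (Submodule F (Fin n → F)) | IsFlag g ∧ g.ncard = k + 1 ∧
        ∃ (M : Matrix (Fin n) (Fin n) F) (σ : Equiv.Perm (Fin n)) (t : ℕ),
          IsMinRep g M ∧ IsLabel (colSpan M '' Set.Icc 1 (n - 1)) σ ∧
          ¬ IsDecreasing σ ∧ Ascent σ t ∧ (∀ t' : ℕ, Ascent σ t' → t ≤ t') ∧
          colSpan M (t + 1) ∉ g}.ncard =
      ∑ σ : Equiv.Perm (Fin n),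
        if IsDecreasing σ then 0
        else Nat.choose ({t : ℕ | Ascent σ t}.ncard - 1) (n - k - 3) *
          Fintype.card F ^
            (∑ j : Fin n, ((σ j : ℕ) - {l : Fin n | l < j ∧ σ l < σ j}.ncard)) := by
  rw [← card_criticalData, ← Set.ncard_coe_finset,
    ← (injOn_flagOmitting_criticalData k).ncard_image]
  congr 1
  ext g
  constructor
  · rintro ⟨hg, hcard, M, σ, t, hmin, hlabel, hdec, hasc, hleast, hnot⟩
    obtain ⟨τ, hτ⟩ := hmin.1.exists_perm
    obtain ⟨hspan, hone, hright⟩ := (isRep_iff hτ).mp hmin.1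
    obtain rfl := (isLabel_colSpan_iff hτ hone hright).mp hlabel
    obtain ⟨C, hC, rfl⟩ := hmin.exists_eq_flagOmitting hg hτ
    obtain rfl : t = firstAscent σ :=
      le_antisymm (hleast _ (ascent_firstAscent hdec)) (Nat.sInf_le hasc)
    have htlt : firstAscent σ < n - 1 := by
      obtain ⟨h, -⟩ := hasc
      omega
    have htC : firstAscent σ ∈ C := by
      by_contra h
      exact hnot ((colSpan_mem_flagOmitting_iff hτ htlt).mpr h)
    have hCr : C ⊆ Finset.range (n - 1) := hC.trans (Finset.filter_subset _ _)
    have hle := Finset.card_le_card hCr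
    rw [ncard_flagOmitting hτ hCr] at hcard
    rw [Finset.card_range] at hle
    refine ⟨⟨σ, M, C.erase (firstAscent σ)⟩, Finset.mem_coe.mpr (mem_criticalData.mpr
      ⟨hdec, ⟨hτ, hone, hright⟩, Finset.erase_subset_erase _ hC, ?_⟩), ?_⟩
    · rw [Finset.card_erase_of_mem htC]
      omega
    · simp only [Finset.insert_erase htC]
  · rintro ⟨⟨σ, M, N⟩, hx, rfl⟩
    obtain ⟨hdec, ⟨hσ, hone, hright⟩, hN, hNcard⟩ := mem_criticalData.mp (Finset.mem_coe.mp hx)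
    have hC := insert_firstAscent_subset hdec hN
    have hasc := ascent_firstAscent hdec
    have htlt : firstAscent σ < n - 1 := by
      obtain ⟨h, -⟩ := hasc
      omega
    have hcard : (flagOmitting M (insert (firstAscent σ) N)).ncard = k + 1 := by
      rw [ncard_flagOmitting hσ (hC.trans (Finset.filter_subset _ _)),
        Finset.card_insert_of_notMem fun h => Finset.notMem_erase _ _ (hN h), hNcard]
      omega
    refine ⟨isFlag_flagOmitting hσ (Set.nonempty_of_ncard_ne_zero (hcard.trans_ne k.succ_ne_zero)), hcard, M, σ,
      firstAscent σ, isMinRep_flagOmitting hσ hone hright hC,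
      (isLabel_colSpan_iff hσ hone hright).mpr rfl, hdec, hasc, fun t' ht' => Nat.sInf_le ht',
      fun h => ?_⟩
    exact (colSpan_mem_flagOmitting_iff hσ htlt).mp h (Finset.mem_insert_self _ _)
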